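/- arXiv:1705.08991 — 7 statements merged into one kernel-verified Lean document; each statement's English description precedes it below -/
import Mathlib

section
/- Let X be a topological space, n a natural number, Θ ⊆ ℝⁿ, and for each θ ∈ Θ let v_θ be a bounded continuous real-valued function on X and r_θ a bounded continuous real-valued function on X×X. Define m_θ(x,y) = v_θ(x) − v_θ(y). Suppose there exists c ∈ ℝ such that for all Borel probability measures μ, ν on X: inf_{θ∈Θ} E_{μ⊗ν}[r_θ] = c, and there exists θ^μ_ν ∈ Θ with E_{μ⊗ν}[r_{θ^μ_ν}] = c and E_{μ⊗ν}[m_{θ^μ_ν}] ≥ 0. Then τ(μ||ν) := sup_{θ∈Θ} E_{μ⊗ν}[m_θ − r_θ] is an adversarial divergence over X, and for every probability measure μ* on X, the set M_{μ*} := {μ : ∀θ∈Θ, E_{μ*}[v_θ] = E_{μ}[v_θ]} is contained in OPT_{τ,μ*}. -/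
open MeasureTheory

/-- A difference `f - g` with `f` integrable integrates to `∫ f - ∫ g`, except that it integrates
to `0` where `g` is not integrable. -/
theorem integral_sub_eq_or_of_integrable_left {α : Type*} [MeasurableSpace α] {μ : Measure α}
    {f g : α → ℝ} (hf : Integrable f μ) :
    ∫ a, (f a - g a) ∂μ = ∫ a, f a ∂μ - ∫ a, g a ∂μ ∨
      (∫ a, g a ∂μ = 0 ∧ ∫ a, (f a - g a) ∂μ = 0) := by
  by_cases hg : Integrable g μ
  · exact Or.inl (integral_sub hf hg)
  · refine Or.inr ⟨integral_undef hg, integral_undef fun h => hg ?_⟩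
    exact (hf.sub h).congr (.of_forall fun a => by simp)

theorem BoundedContinuousFunction.integrable_comp_fst_prod {X : Type*} [TopologicalSpace X]
    [MeasurableSpace X] [OpensMeasurableSpace X] (f : BoundedContinuousFunction X ℝ)
    (μ ν : Measure X) [IsFiniteMeasure μ] [IsFiniteMeasure ν] :
    Integrable (fun p : X × X => f p.1) (μ.prod ν) :=
  (f.integrable μ).comp_fst ν

theorem BoundedContinuousFunction.integrable_comp_snd_prod {X : Type*} [TopologicalSpace X]
    [MeasurableSpace X] [OpensMeasurableSpace X] (f : BoundedContinuousFunction X ℝ)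
    (μ ν : Measure X) [IsFiniteMeasure μ] [IsFiniteMeasure ν] :
    Integrable (fun p : X × X => f p.2) (μ.prod ν) :=
  (f.integrable ν).comp_snd μ

theorem BoundedContinuousFunction.integral_sub_prod {X : Type*} [TopologicalSpace X]
    [MeasurableSpace X] [OpensMeasurableSpace X] (f : BoundedContinuousFunction X ℝ)
    (μ ν : Measure X) [IsProbabilityMeasure μ] [IsProbabilityMeasure ν] :
    ∫ p, (f p.1 - f p.2) ∂(μ.prod ν) = ∫ x, f x ∂μ - ∫ x, f x ∂ν := by
  rw [integral_sub (f.integrable_comp_fst_prod μ ν) (f.integrable_comp_snd_prod μ ν),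
    integral_fun_fst, integral_fun_snd]
  simp

/-- If the residuals `r_θ` have a common infimum `c` over all pairs of
probability measures, attained at some `θ^μ_ν` where moreover the matching term is
nonnegative, then `τ(μ‖ν) = sup_{θ∈Θ} E_{μ⊗ν}[m_θ - r_θ]` is an adversarial divergence
(a supremum of expectations over a nonempty family of bounded continuous functions on `X × X`),
and the generalized-moment-matching set `M_{μ*}` is contained in `OPT_{τ,μ*}`. -/
theorem stmt0 {X : Type*} [TopologicalSpace X] [MeasurableSpace X] [BorelSpace X] [Nonempty X]
    {n : ℕ} (Θ : Set (Fin n → ℝ))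
    (v : (Fin n → ℝ) → BoundedContinuousFunction X ℝ)
    (r : (Fin n → ℝ) → BoundedContinuousFunction (X × X) ℝ)
    (c : ℝ)
    (hinf : ∀ μ ν : ProbabilityMeasure X,
      IsGLB ((fun θ => ∫ p, r θ p ∂((μ : Measure X).prod (ν : Measure X))) '' Θ) c)
    (hach : ∀ μ ν : ProbabilityMeasure X, ∃ θ₀ ∈ Θ,
      (∫ p, r θ₀ p ∂((μ : Measure X).prod (ν : Measure X))) = c ∧
      0 ≤ ∫ p, (v θ₀ p.1 - v θ₀ p.2) ∂((μ : Measure X).prod (ν : Measure X)))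
    (τ : ProbabilityMeasure X → ProbabilityMeasure X → EReal)
    (hτ : ∀ μ ν : ProbabilityMeasure X, τ μ ν = ⨆ θ ∈ Θ,
      (((∫ p, (v θ p.1 - v θ p.2 - r θ p) ∂((μ : Measure X).prod (ν : Measure X))) : ℝ) : EReal)) :
    (∃ F : Set (BoundedContinuousFunction (X × X) ℝ), F.Nonempty ∧
      ∀ μ ν : ProbabilityMeasure X,
        τ μ ν = ⨆ f ∈ F,
          (((∫ p, f p ∂((μ : Measure X).prod (ν : Measure X))) : ℝ) : EReal)) ∧
    ∀ μstar : ProbabilityMeasure X,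
      {μ : ProbabilityMeasure X | ∀ θ ∈ Θ,
          ∫ x, v θ x ∂(μstar : Measure X) = ∫ x, v θ x ∂(μ : Measure X)} ⊆
      {μ : ProbabilityMeasure X |
          τ μstar μ = ⨅ μ' : ProbabilityMeasure X, τ μstar μ'} := by
  have hm : ∀ (μ ν : ProbabilityMeasure X) (θ : Fin n → ℝ),
      Integrable (fun p : X × X => v θ p.1 - v θ p.2) ((μ : Measure X).prod (ν : Measure X)) :=
    fun μ ν θ => ((v θ).integrable_comp_fst_prod _ _).sub ((v θ).integrable_comp_snd_prod _ _)
  have lower : ∀ μ ν : ProbabilityMeasure X, ((-c : ℝ) : EReal) ≤ τ μ ν := by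
    intro μ ν
    obtain ⟨θ, hθ, hr, hnn⟩ := hach μ ν
    rw [hτ]
    refine le_iSup₂_of_le θ hθ (EReal.coe_le_coe_iff.2 ?_)
    rcases integral_sub_eq_or_of_integrable_left (g := r θ) (hm μ ν θ) with h | ⟨h₀, h⟩ <;>
      linarith
  refine ⟨⟨(fun θ => (v θ).compContinuous ⟨Prod.fst, continuous_fst⟩ -
    (v θ).compContinuous ⟨Prod.snd, continuous_snd⟩ - r θ) '' Θ, ?_, ?_⟩, ?_⟩
  · obtain ⟨x⟩ := ‹Nonempty X›
    let δ : ProbabilityMeasure X := ⟨Measure.dirac x, inferInstance⟩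
    obtain ⟨θ, hθ, -⟩ := hach δ δ
    exact ⟨_, θ, hθ, rfl⟩
  · intro μ ν
    rw [hτ, iSup_image]
    rfl
  · intro μstar μ hμ
    refine le_antisymm (le_trans ?_ (le_iInf fun μ' => lower μstar μ')) (iInf_le _ μ)
    rw [hτ]
    refine iSup₂_le fun θ hθ => EReal.coe_le_coe_iff.2 ?_
    have hc := (hinf μstar μ).1 ⟨θ, hθ, rfl⟩
    have hmθ := (v θ).integral_sub_prod (μstar : Measure X) (μ : Measure X)
    have hvθ := hμ θ hθ
    rcases integral_sub_eq_or_of_integrable_left (g := r θ) (hm μstar μ θ) with h | ⟨h₀, h⟩ <;>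
      dsimp only at hc <;> linarith
end

section
/- Let X be a topological space, Θ an index set, and for each θ ∈ Θ let v_θ be a bounded continuous real-valued function on X and r_θ a bounded continuous real-valued function on X×X; set m_θ(x,y) = v_θ(x) − v_θ(y). Suppose there exists c ∈ ℝ such that for all Borel probability measures μ, ν on X: inf_{θ∈Θ} E_{μ⊗ν}[r_θ] = c, and there exists θ^μ_ν ∈ Θ with E_{μ⊗ν}[r_{θ^μ_ν}] = c and E_{μ⊗ν}[m_{θ^μ_ν}] ≥ 0. Define τ(μ||ν) = sup_{θ∈Θ} E_{μ⊗ν}[m_θ − r_θ]. Then for all probability measures μ, ν on X one has τ(μ||ν) ≥ −c, and for every probability measure μ one has τ(μ||μ) = −c; in particular inf_{ν∈P(X)} τ(μ||ν) = −c. -/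
open MeasureTheory

/-- The matching term `v x - v y` of a bounded continuous `v` is integrable for `μ ⊗ ν`. -/
theorem integrable_prod_sub_boundedContinuous {X : Type*} [TopologicalSpace X]
    [MeasurableSpace X] [BorelSpace X] (v : BoundedContinuousFunction X ℝ)
    (μ ν : Measure X) [IsFiniteMeasure μ] [IsFiniteMeasure ν] :
    Integrable (fun p : X × X => v p.1 - v p.2) (μ.prod ν) :=
  ((v.integrable μ).comp_fst ν).sub ((v.integrable ν).comp_snd μ)

/-- The matching term has mean zero for `μ ⊗ μ`. -/
theorem integral_prod_self_sub_boundedContinuous {X : Type*} [TopologicalSpace X]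
    [MeasurableSpace X] [BorelSpace X] (v : BoundedContinuousFunction X ℝ)
    (μ : Measure X) [IsFiniteMeasure μ] :
    ∫ p : X × X, (v p.1 - v p.2) ∂(μ.prod μ) = 0 := by
  rw [integral_sub ((v.integrable μ).comp_fst μ) ((v.integrable μ).comp_snd μ),
    integral_fun_fst (fun x => v x), integral_fun_snd (fun x => v x), sub_self]

/-- Subtracting `g` from an integrable `f` either splits the integral, or `g` is not integrable and
both integrals involving `g` take the default value `0`. -/
theorem integral_sub_eq_or_eq_zero {Ω : Type*} [MeasurableSpace Ω] {P : Measure Ω} {f g : Ω → ℝ}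
    (hf : Integrable f P) :
    ∫ x, (f x - g x) ∂P = ∫ x, f x ∂P - ∫ x, g x ∂P ∨
      (∫ x, g x ∂P = 0 ∧ ∫ x, (f x - g x) ∂P = 0) := by
  by_cases hg : Integrable g P
  · exact Or.inl (integral_sub hf hg)
  · refine Or.inr ⟨integral_undef hg, integral_undef fun h => hg ?_⟩
    exact (hf.sub h).congr (.of_forall fun x => sub_sub_cancel (f x) (g x))

/-- Under the common-infimum/attainment hypotheses on the residuals `r_θ`
(with nonnegative matching term at the attaining index), the objective
`τ(μ‖ν) = sup_θ E_{μ⊗ν}[m_θ - r_θ]` satisfies `τ(μ‖ν) ≥ -c` for all `μ, ν`,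
`τ(μ‖μ) = -c` for all `μ`, and in particular `inf_ν τ(μ‖ν) = -c`. -/
theorem stmt1 {X : Type*} [TopologicalSpace X] [MeasurableSpace X] [BorelSpace X]
    {Θ : Type*}
    (v : Θ → BoundedContinuousFunction X ℝ)
    (r : Θ → BoundedContinuousFunction (X × X) ℝ)
    (c : ℝ)
    (hinf : ∀ μ ν : ProbabilityMeasure X,
      IsGLB (Set.range fun θ => ∫ p, r θ p ∂((μ : Measure X).prod (ν : Measure X))) c)
    (hach : ∀ μ ν : ProbabilityMeasure X, ∃ θ₀ : Θ,
      (∫ p, r θ₀ p ∂((μ : Measure X).prod (ν : Measure X))) = c ∧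
      0 ≤ ∫ p, (v θ₀ p.1 - v θ₀ p.2) ∂((μ : Measure X).prod (ν : Measure X)))
    (τ : ProbabilityMeasure X → ProbabilityMeasure X → EReal)
    (hτ : ∀ μ ν : ProbabilityMeasure X, τ μ ν = ⨆ θ : Θ,
      (((∫ p, (v θ p.1 - v θ p.2 - r θ p) ∂((μ : Measure X).prod (ν : Measure X))) : ℝ) : EReal)) :
    (∀ μ ν : ProbabilityMeasure X, ((-c : ℝ) : EReal) ≤ τ μ ν) ∧
    (∀ μ : ProbabilityMeasure X, τ μ μ = ((-c : ℝ) : EReal)) ∧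
    (∀ μ : ProbabilityMeasure X,
      (⨅ ν : ProbabilityMeasure X, τ μ ν) = ((-c : ℝ) : EReal)) := by
  have lower : ∀ μ ν : ProbabilityMeasure X, ((-c : ℝ) : EReal) ≤ τ μ ν := by
    intro μ ν
    obtain ⟨θ, hr, hm⟩ := hach μ ν
    rw [hτ]
    refine le_iSup_of_le θ (EReal.coe_le_coe_iff.2 ?_)
    rcases integral_sub_eq_or_eq_zero (g := r θ)
      (integrable_prod_sub_boundedContinuous (v θ) μ ν) with h | ⟨h₀, h⟩ <;> linarith
  have diag : ∀ μ : ProbabilityMeasure X, τ μ μ = ((-c : ℝ) : EReal) := by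
    intro μ
    refine le_antisymm ?_ (lower μ μ)
    rw [hτ]
    refine iSup_le fun θ => EReal.coe_le_coe_iff.2 ?_
    have hc := (hinf μ μ).1 (Set.mem_range_self θ)
    have hm := integral_prod_self_sub_boundedContinuous (v θ) (μ : Measure X)
    rcases integral_sub_eq_or_eq_zero (g := r θ)
      (integrable_prod_sub_boundedContinuous (v θ) μ μ) with h | ⟨h₀, h⟩ <;> linarith
  exact ⟨lower, diag, fun μ => le_antisymm (iInf_le_of_le μ (diag μ).le) (le_iInf (lower μ))⟩
end

section
/- Let X be a compact topological space. Let f: ℝ → ℝ∪{+∞} be a convex lower semi-continuous function whose convex conjugate f* satisfies: f*(x) ≥ x for all x ∈ ℝ, f* is continuously differentiable on the interior of its effective domain, and there exists x₀ in the interior of the effective domain of f* with f*(x₀) = x₀. Let ψ = (ψ₁,…,ψₙ) be a vector of continuously differentiable real-valued functions on X, and let Θ = {θ ∈ ℝ^{n+1} : for all x ∈ X, θᵀ(ψ(x),1) ∈ dom f*}. Define the linear f-GAN objective τ(μ||ν) = sup_{θ∈Θ} ( E_μ[θᵀ(ψ,1)] − E_ν[f*∘(θᵀ(ψ,1))] )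 on pairs of Borel probability measures on X. Then for every probability measure μ* on X: OPT_{τ,μ*} = {μ : τ(μ*||μ) = 0} = {μ : E_{μ*}[ψ] = E_{μ}[ψ]}, and in particular μ* ∈ OPT_{τ,μ*}. -/
open MeasureTheory

/-- A supremum of affine functions is quasiconvex. -/
theorem iSup_affine_le_max {f g : ℝ → EReal}
    (hg : ∀ t : ℝ, g t = ⨆ x : ℝ, (((t * x : ℝ) : EReal) - f x))
    {a b t : ℝ} (hat : a ≤ t) (htb : t ≤ b) : g t ≤ max (g a) (g b) := by
  rw [hg t]
  refine iSup_le fun x => ?_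
  rcases le_total 0 x with hx | hx
  · refine le_max_of_le_right ?_
    rw [hg b]
    refine le_trans (EReal.sub_le_sub ?_ le_rfl) (le_iSup (fun x : ℝ => ((b * x : ℝ) : EReal) - f x) x)
    exact_mod_cast mul_le_mul_of_nonneg_right htb hx
  · refine le_max_of_le_left ?_
    rw [hg a]
    refine le_trans (EReal.sub_le_sub ?_ le_rfl) (le_iSup (fun x : ℝ => ((a * x : ℝ) : EReal) - f x) x)
    exact_mod_cast mul_le_mul_of_nonpos_right hat hx

theorem measurable_of_le_max {g : ℝ → EReal}
    (hg : ∀ a b t : ℝ, a ≤ t → t ≤ b → g t ≤ max (g a) (g b)) : Measurable g := by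
  refine measurable_of_Iic fun c => Set.OrdConnected.measurableSet ⟨?_⟩
  intro a ha b hb t ht
  exact (hg a b t ht.1 ht.2).trans (max_le ha hb)

theorem integrable_of_continuous {X : Type*} [TopologicalSpace X] [CompactSpace X]
    [MeasurableSpace X] [BorelSpace X] (ν : Measure X) [IsFiniteMeasure ν]
    {φ : X → ℝ} (hφ : Continuous φ) : Integrable φ ν := by
  obtain ⟨C, hC⟩ := isCompact_univ.exists_bound_of_continuousOn hφ.continuousOn
  exact Integrable.of_bound hφ.measurable.aestronglyMeasurable C
    (Filter.Eventually.of_forall fun x => hC x trivial)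

theorem integrable_toReal_comp {X : Type*} [TopologicalSpace X] [CompactSpace X]
    [MeasurableSpace X] [BorelSpace X] (ν : Measure X) [IsFiniteMeasure ν] {g : ℝ → EReal}
    (hg : ∀ a b t : ℝ, a ≤ t → t ≤ b → g t ≤ max (g a) (g b))
    (hge : ∀ x : ℝ, (x : EReal) ≤ g x) {h : X → ℝ} (hh : Continuous h)
    (hdom : ∀ x, g (h x) ≠ ⊤) : Integrable (fun x => (g (h x)).toReal) ν := by
  rcases isEmpty_or_nonempty X with hX | hX
  · rw [Measure.eq_zero_of_isEmpty ν]
    exact integrable_zero_measure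
  obtain ⟨p, -, hp⟩ := isCompact_univ.exists_isMinOn Set.univ_nonempty hh.continuousOn
  obtain ⟨q, -, hq⟩ := isCompact_univ.exists_isMaxOn Set.univ_nonempty hh.continuousOn
  have hbot : ∀ t, g t ≠ ⊥ := fun t => ne_bot_of_le_ne_bot (EReal.coe_ne_bot t) (hge t)
  refine Integrable.of_mem_Icc (h p) (max (g (h p)) (g (h q))).toReal
    ((measurable_of_le_max hg).comp hh.measurable).ereal_toReal.aemeasurable
    (Filter.Eventually.of_forall fun x => ⟨?_, ?_⟩)
  · refine (hp (Set.mem_univ x)).trans ?_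
    have := EReal.toReal_le_toReal (hge (h x)) (EReal.coe_ne_bot _) (hdom x)
    simpa using this
  · refine EReal.toReal_le_toReal (hg _ _ _ (hp (Set.mem_univ x)) (hq (Set.mem_univ x)))
      (hbot _) ?_
    rcases max_choice (g (h p)) (g (h q)) with h' | h' <;> rw [h'] <;> exact hdom _

theorem hasDerivAt_toReal_one {g : ℝ → EReal} (hge : ∀ x : ℝ, (x : EReal) ≤ g x)
    (hC1 : ContDiffOn ℝ 1 (fun t => (g t).toReal) (interior {t : ℝ | g t ≠ ⊤}))
    {x₀ : ℝ} (hx₀mem : x₀ ∈ interior {t : ℝ | g t ≠ ⊤}) (hx₀ : g x₀ = (x₀ : EReal)) :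
    HasDerivAt (fun t => (g t).toReal) 1 x₀ := by
  have hd := ((hC1.contDiffAt (isOpen_interior.mem_nhds hx₀mem)).differentiableAt
    one_ne_zero).hasDerivAt
  have hmin : IsLocalMin (fun t => (g t).toReal - t) x₀ := by
    filter_upwards [isOpen_interior.mem_nhds hx₀mem] with t ht
    have := EReal.toReal_le_toReal (hge t) (EReal.coe_ne_bot _) (interior_subset ht)
    simp only [hx₀, EReal.toReal_coe] at this ⊢
    linarith
  have h0 := hmin.hasDerivAt_eq_zero (hd.sub (hasDerivAt_id x₀))
  rwa [sub_eq_zero.mp h0] at hd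

theorem integral_eq_of_forall_perturbation_nonpos {X : Type*} [TopologicalSpace X]
    [CompactSpace X] [MeasurableSpace X] [BorelSpace X]
    (μ ν : Measure X) [IsProbabilityMeasure μ] [IsProbabilityMeasure ν] {g : ℝ → EReal}
    (hg : ∀ a b t : ℝ, a ≤ t → t ≤ b → g t ≤ max (g a) (g b))
    (hge : ∀ x : ℝ, (x : EReal) ≤ g x) {x₀ : ℝ}
    (hx₀mem : x₀ ∈ interior {t : ℝ | g t ≠ ⊤}) (hx₀ : g x₀ = (x₀ : EReal))
    (hderiv : HasDerivAt (fun t => (g t).toReal) 1 x₀)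
    {φ : X → ℝ} (hφ : Continuous φ)
    (H : ∀ s : ℝ, (∀ x, g (s * φ x + x₀) ≠ ⊤) →
      ∫ x, (s * φ x + x₀) ∂μ - ∫ x, (g (s * φ x + x₀)).toReal ∂ν ≤ 0) :
    ∫ x, φ x ∂μ = ∫ x, φ x ∂ν := by
  obtain ⟨C, hC⟩ := isCompact_univ.exists_bound_of_continuousOn hφ.continuousOn
  set M := max C 1
  have hM : 0 < M := lt_max_of_lt_right one_pos
  have hφM : ∀ x, |φ x| ≤ M := fun x => (hC x trivial).trans (le_max_left _ _)
  refine eq_of_abs_sub_le_all fun η hη => ?_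
  have hev : ∀ᶠ t in nhds x₀, g t ≠ ⊤ ∧ (g t).toReal ≤ t + η / M * |t - x₀| := by
    have hlo := hasDerivAt_iff_isLittleO.mp hderiv
    filter_upwards [hlo.bound (div_pos hη hM), isOpen_interior.mem_nhds hx₀mem] with t ht htd
    refine ⟨interior_subset htd, ?_⟩
    have := (le_abs_self _).trans ht
    simp only [hx₀, EReal.toReal_coe, smul_eq_mul, mul_one, Real.norm_eq_abs] at this
    linarith
  obtain ⟨r, hr, hball⟩ := Metric.eventually_nhds_iff.mp hev
  have hiφμ := integrable_of_continuous μ hφ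
  have hiφν := integrable_of_continuous ν hφ
  have key : ∀ s : ℝ, |s| * M < r → s * (∫ x, φ x ∂μ - ∫ x, φ x ∂ν) ≤ |s| * η := by
    intro s hs
    have hsx : ∀ x, |s * φ x| ≤ |s| * M := fun x => by
      rw [abs_mul]
      exact mul_le_mul_of_nonneg_left (hφM x) (abs_nonneg s)
    have hb : ∀ x, g (s * φ x + x₀) ≠ ⊤ ∧
        (g (s * φ x + x₀)).toReal ≤ s * φ x + x₀ + |s| * η := fun x => by
      have hb := @hball (s * φ x + x₀) (by
        rw [Real.dist_eq, add_sub_cancel_right]; exact (hsx x).trans_lt hs)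
      refine ⟨hb.1, hb.2.trans ?_⟩
      rw [add_sub_cancel_right]
      have := mul_le_mul_of_nonneg_left (hsx x) (div_pos hη hM).le
      have h2 : η / M * (|s| * M) = |s| * η := by field_simp
      linarith
    have h1 := H s fun x => (hb x).1
    have h2 : ∫ x, (g (s * φ x + x₀)).toReal ∂ν ≤ ∫ x, (s * φ x + x₀ + |s| * η) ∂ν :=
      integral_mono
        (integrable_toReal_comp ν hg hge ((hφ.const_mul s).add_const x₀) fun x => (hb x).1)
        (((hiφν.const_mul s).add (integrable_const x₀)).add (integrable_const _))
        fun x => (hb x).2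
    rw [integral_add (f := fun x => s * φ x + x₀)
        ((hiφν.const_mul s).add (integrable_const x₀)) (integrable_const _),
      integral_add (hiφν.const_mul s) (integrable_const x₀), integral_const_mul] at h2
    rw [integral_add (hiφμ.const_mul s) (integrable_const x₀), integral_const_mul] at h1
    simp only [integral_const, probReal_univ, one_smul] at h1 h2
    linarith
  have hε : 0 < r / (2 * M) := by positivity
  have hεr : |r / (2 * M)| * M < r := by
    rw [abs_of_pos hε]
    have : r / (2 * M) * M = r / 2 := by field_simp
    linarith
  have k1 := key _ hεr
  have k2 := key (-(r / (2 * M))) (by rwa [abs_neg])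
  rw [abs_neg] at k2
  rw [abs_of_pos hε] at k1 k2
  rw [abs_le]
  constructor
  · rw [neg_mul, ← mul_neg] at k2
    exact neg_le.mp (le_of_mul_le_mul_left k2 hε)
  · exact le_of_mul_le_mul_left k1 hε

/-- linear f-GAN: Let `X` be compact, `f : ℝ → ℝ ∪ {+∞}` convex and lower
semi-continuous with convex conjugate `f*` satisfying `f*(x) ≥ x`, `f*` continuously
differentiable on the interior of its effective domain, and `f*(x₀) = x₀` for some interior
point `x₀`. For the linear discriminator class built from the feature maps `ψ`, the
optimal set of the linear f-GAN objective `τ(μ*‖·)` equals `{μ : τ(μ*‖μ) = 0}`, equals the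
set of `μ` matching all the `ψ`-moments of `μ*`, and contains `μ*`. -/
theorem stmt3 {X : Type*} [TopologicalSpace X] [CompactSpace X]
    [MeasurableSpace X] [BorelSpace X]
    {n : ℕ} (ψ : Fin n → X → ℝ) (hψ : ∀ i, Continuous (ψ i))
    (f : ℝ → EReal) (hf_bot : ∀ x : ℝ, f x ≠ ⊥)
    (hf_cvx : ∀ a b x y : ℝ, 0 ≤ a → 0 ≤ b → a + b = 1 →
      f (a * x + b * y) ≤ (a : EReal) * f x + (b : EReal) * f y)
    (hf_lsc : LowerSemicontinuous f)
    (fstar : ℝ → EReal)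
    (hfstar : ∀ t : ℝ, fstar t = ⨆ x : ℝ, (((t * x : ℝ) : EReal) - f x))
    (hge : ∀ x : ℝ, (x : EReal) ≤ fstar x)
    (hC1 : ContDiffOn ℝ 1 (fun t => (fstar t).toReal) (interior {t : ℝ | fstar t ≠ ⊤}))
    (x₀ : ℝ) (hx₀mem : x₀ ∈ interior {t : ℝ | fstar t ≠ ⊤})
    (hx₀ : fstar x₀ = (x₀ : EReal))
    (Θ : Set (Fin (n + 1) → ℝ))
    (hΘ : Θ = {θ : Fin (n + 1) → ℝ | ∀ x : X,
      fstar ((∑ i : Fin n, θ i.castSucc * ψ i x) + θ (Fin.last n)) ≠ ⊤})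
    (τ : ProbabilityMeasure X → ProbabilityMeasure X → EReal)
    (hτ : ∀ μ ν : ProbabilityMeasure X, τ μ ν = ⨆ θ ∈ Θ,
      ((((∫ x, ((∑ i : Fin n, θ i.castSucc * ψ i x) + θ (Fin.last n)) ∂(μ : Measure X)) -
        ∫ y, (fstar ((∑ i : Fin n, θ i.castSucc * ψ i y) + θ (Fin.last n))).toReal
          ∂(ν : Measure X)) : ℝ) : EReal)) :
    ∀ μstar : ProbabilityMeasure X,
      ({μ : ProbabilityMeasure X | τ μstar μ = ⨅ μ' : ProbabilityMeasure X, τ μstar μ'} =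
        {μ : ProbabilityMeasure X | τ μstar μ = 0}) ∧
      ({μ : ProbabilityMeasure X | τ μstar μ = ⨅ μ' : ProbabilityMeasure X, τ μstar μ'} =
        {μ : ProbabilityMeasure X | ∀ i : Fin n,
          ∫ x, ψ i x ∂(μstar : Measure X) = ∫ x, ψ i x ∂(μ : Measure X)}) ∧
      τ μstar μstar = ⨅ μ' : ProbabilityMeasure X, τ μstar μ' := by
  intro μstar
  have hq : ∀ a b t : ℝ, a ≤ t → t ≤ b → fstar t ≤ max (fstar a) (fstar b) :=
    fun a b t => iSup_affine_le_max hfstar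
  have hcont : ∀ θ : Fin (n + 1) → ℝ,
      Continuous fun x => (∑ i : Fin n, θ i.castSucc * ψ i x) + θ (Fin.last n) := fun θ => by
    fun_prop
  have hnonneg : ∀ μ, 0 ≤ τ μstar μ := by
    intro μ
    have hmem : (Fin.snoc (fun _ => 0) x₀ : Fin (n + 1) → ℝ) ∈ Θ := by
      rw [hΘ]
      intro x
      simp [hx₀]
    rw [hτ]
    refine le_trans ?_ (le_iSup₂ (Fin.snoc (fun _ => 0) x₀ : Fin (n + 1) → ℝ) hmem)
    simp [hx₀]
  have hmatch : ∀ μ : ProbabilityMeasure X, (∀ i : Fin n,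
      ∫ x, ψ i x ∂(μstar : Measure X) = ∫ x, ψ i x ∂(μ : Measure X)) → τ μstar μ = 0 := by
    intro μ hμ
    refine le_antisymm ?_ (hnonneg μ)
    rw [hτ]
    refine iSup₂_le fun θ hθ => ?_
    rw [hΘ] at hθ
    have hint : ∀ ν : ProbabilityMeasure X,
        ∫ x, ((∑ i : Fin n, θ i.castSucc * ψ i x) + θ (Fin.last n)) ∂(ν : Measure X) =
          (∑ i : Fin n, θ i.castSucc * ∫ x, ψ i x ∂(ν : Measure X)) + θ (Fin.last n) := by
      intro ν
      have hi : ∀ i : Fin n, Integrable (fun x => θ i.castSucc * ψ i x) (ν : Measure X) :=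
        fun i => (integrable_of_continuous _ (hψ i)).const_mul _
      rw [integral_add (integrable_finsetSum _ fun i _ => hi i) (integrable_const _),
        integral_finsetSum _ fun i _ => hi i]
      simp [integral_const_mul]
    have hle : ∫ x, ((∑ i : Fin n, θ i.castSucc * ψ i x) + θ (Fin.last n)) ∂(μ : Measure X) ≤
        ∫ x, (fstar ((∑ i : Fin n, θ i.castSucc * ψ i x) + θ (Fin.last n))).toReal
          ∂(μ : Measure X) :=
      integral_mono (integrable_of_continuous _ (hcont θ))
        (integrable_toReal_comp _ hq hge (hcont θ) hθ) fun x =>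
          (EReal.toReal_coe _).symm.trans_le
            (EReal.toReal_le_toReal (hge _) (EReal.coe_ne_bot _) (hθ x))
    have heq : ∫ x, ((∑ i : Fin n, θ i.castSucc * ψ i x) + θ (Fin.last n))
          ∂(μstar : Measure X) =
        ∫ x, ((∑ i : Fin n, θ i.castSucc * ψ i x) + θ (Fin.last n)) ∂(μ : Measure X) := by
      rw [hint, hint]
      simp only [hμ]
    rw [heq]
    exact_mod_cast sub_nonpos.mpr hle
  have hself : τ μstar μstar = 0 := hmatch μstar fun _ => rfl
  have hinf : ⨅ μ' : ProbabilityMeasure X, τ μstar μ' = 0 :=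
    le_antisymm ((iInf_le _ μstar).trans_eq hself) (le_iInf hnonneg)
  rw [hinf]
  refine ⟨rfl, ?_, hself⟩
  ext μ
  refine ⟨fun hμ i => ?_, hmatch μ⟩
  refine integral_eq_of_forall_perturbation_nonpos _ _ hq hge hx₀mem hx₀
    (hasDerivAt_toReal_one hge hC1 hx₀mem hx₀) (hψ i) fun s hs => ?_
  have hμ : τ μstar μ = 0 := hμ
  let θ : Fin (n + 1) → ℝ := Fin.snoc (Pi.single i s) x₀
  have hval : ∀ x, (∑ j : Fin n, θ j.castSucc * ψ j x) + θ (Fin.last n) = s * ψ i x + x₀ := by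
    intro x
    simp [θ, Pi.single_apply]
  have hmem : θ ∈ Θ := by
    rw [hΘ]
    intro x
    rw [hval]
    exact hs x
  rw [hτ] at hμ
  have hle := (le_iSup₂ (f := fun (θ : Fin (n + 1) → ℝ) (_ : θ ∈ Θ) =>
    ((((∫ x, ((∑ i : Fin n, θ i.castSucc * ψ i x) + θ (Fin.last n)) ∂(μstar : Measure X)) -
      ∫ y, (fstar ((∑ i : Fin n, θ i.castSucc * ψ i y) + θ (Fin.last n))).toReal
        ∂(μ : Measure X)) : ℝ) : EReal)) θ hmem).trans_eq hμ
  simp only [hval] at hle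
  exact_mod_cast hle
end

section
/- Let X be a compact metric space, F a nonempty set of bounded continuous real-valued functions on X×X, and τ the adversarial divergence over X determined by F. Then for every Borel probability measure μ* on X, the function μ ↦ τ(μ*||μ) attains its infimum on P(X); that is, OPT_{τ,μ*} is nonempty. -/
open MeasureTheory

/-- The adversarial divergence over `X` determined by a family `F` of bounded continuous
functions on `X × X`: `τ(μ‖ν) = sup_{f ∈ F} E_{μ⊗ν}[f]`, with values in `ℝ ∪ {±∞}`. -/
noncomputable def advDiv {X : Type*} [TopologicalSpace X] [MeasurableSpace X]
    (F : Set (BoundedContinuousFunction (X × X) ℝ))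
    (μ ν : ProbabilityMeasure X) : EReal :=
  ⨆ f ∈ F, (((∫ p, f p ∂((μ : Measure X).prod (ν : Measure X))) : ℝ) : EReal)

/-- An adversarial divergence on a compact metric space is weakly lower semicontinuous in its
second argument. -/
theorem lowerSemicontinuous_advDiv {X : Type*} [MetricSpace X] [CompactSpace X]
    [MeasurableSpace X] [BorelSpace X]
    (F : Set (BoundedContinuousFunction (X × X) ℝ)) (μ : ProbabilityMeasure X) :
    LowerSemicontinuous (advDiv F μ) :=
  lowerSemicontinuous_biSup fun f _ ↦ (continuous_coe_real_ereal.comp <|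
    (ProbabilityMeasure.continuous_integral_boundedContinuousFunction f).comp <|
      ProbabilityMeasure.continuous_prod.comp (Continuous.prodMk_right μ)).lowerSemicontinuous

/-- On a compact metric space, any adversarial divergence `τ` determined by a
nonempty family of bounded continuous functions attains its infimum in the second argument:
`OPT_{τ,μ*}` is nonempty for every probability measure `μ*`. -/
theorem stmt5 {X : Type*} [MetricSpace X] [CompactSpace X]
    [MeasurableSpace X] [BorelSpace X]
    (F : Set (BoundedContinuousFunction (X × X) ℝ)) (hF : F.Nonempty)
    (μstar : ProbabilityMeasure X) :
    ∃ μ : ProbabilityMeasure X,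
      advDiv F μstar μ = ⨅ μ' : ProbabilityMeasure X, advDiv F μstar μ' := by
  obtain ⟨μ, -, hμ⟩ := LowerSemicontinuousOn.exists_isMinOn ⟨μstar, Set.mem_univ _⟩ isCompact_univ
    ((lowerSemicontinuous_advDiv F μstar).lowerSemicontinuousOn Set.univ)
  exact ⟨μ, le_antisymm (le_iInf fun ν ↦ hμ (Set.mem_univ ν)) (iInf_le _ μ)⟩
end

section
/- Let X be a compact metric space, F a nonempty set of bounded continuous real-valued functions on X×X, and τ the adversarial divergence over X determined by F. Then for every Borel probability measure μ* on X, the function μ ↦ τ(μ*||μ), with values in ℝ∪{+∞}, is lower semi-continuous on P(X) with respect to the weak-* topology. -/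
open MeasureTheory

/-- For fixed `μ`, the expectation of a bounded continuous function under `μ ⊗ ν` depends
continuously on `ν`. -/
lemma continuous_integral_prod_right {X : Type*} [MetricSpace X] [CompactSpace X]
    [MeasurableSpace X] [BorelSpace X] (f : BoundedContinuousFunction (X × X) ℝ)
    (μ : ProbabilityMeasure X) :
    Continuous fun ν : ProbabilityMeasure X =>
      ∫ p, f p ∂((μ : Measure X).prod (ν : Measure X)) := by
  have hg : Continuous fun y => ∫ x, f (x, y) ∂(μ : Measure X) :=
    continuous_of_dominated (bound := fun _ => ‖f‖)
      (fun y => (f.continuous.comp (by fun_prop)).aestronglyMeasurable)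
      (fun y => .of_forall fun x => f.norm_coe_le_norm (x, y))
      (integrable_const _)
      (.of_forall fun x => f.continuous.comp (by fun_prop))
  have hswap (ν : ProbabilityMeasure X) :
      ∫ p, f p ∂((μ : Measure X).prod (ν : Measure X)) =
        ∫ y, BoundedContinuousFunction.mkOfCompact ⟨_, hg⟩ y ∂(ν : Measure X) :=
    integral_prod_symm _ (f.integrable _)
  simp_rw [hswap]
  exact ProbabilityMeasure.continuous_integral_boundedContinuousFunction _

/-- On a compact metric space, for any adversarial divergence `τ` determined
by a nonempty family `F` of bounded continuous functions and any probability measure `μ*`,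
the map `μ ↦ τ(μ*‖μ)` is lower semi-continuous on `P(X)` for the weak-* topology
(the topology of weak convergence carried by `ProbabilityMeasure X`). -/
theorem stmt8 {X : Type*} [MetricSpace X] [CompactSpace X]
    [MeasurableSpace X] [BorelSpace X]
    (F : Set (BoundedContinuousFunction (X × X) ℝ)) (hF : F.Nonempty)
    (μstar : ProbabilityMeasure X) :
    LowerSemicontinuous (fun μ : ProbabilityMeasure X => advDiv F μstar μ) := by
  unfold advDiv
  exact lowerSemicontinuous_biSup fun f _ =>
    (continuous_coe_real_ereal.comp (continuous_integral_prod_right f μstar)).lowerSemicontinuous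
end

section
/- Let X be a topological space and let V be the set of continuous functions u: X → (0,1) (which are automatically bounded). Define the GAN objective τ(μ||ν) = sup_{u∈V} E_{x∼μ, y∼ν}[ log u(x) + log(1 − u(y)) ] for Borel probability measures μ, ν on X. Then for every probability measure μ on X, τ(μ||μ) = −log 4, and for all probability measures μ, ν on X, τ(μ||ν) ≥ −log 4. -/
open MeasureTheory

/-- The pointwise inequality `log t + log (1 - t) ≤ -log 4` on `(0,1)`. -/
theorem log_add_log_one_sub_le {t : ℝ} (ht : t ∈ Set.Ioo (0 : ℝ) 1) :
    Real.log t + Real.log (1 - t) ≤ -Real.log 4 := by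
  have h1 : 0 < 1 - t := sub_pos.2 ht.2
  rw [← Real.log_mul ht.1.ne' h1.ne', ← Real.log_inv]
  exact Real.log_le_log (mul_pos ht.1 h1) (by nlinarith [sq_nonneg (2 * t - 1)])

/-- If `(x, y) ↦ g x + h y` is bounded, then `g` and `h` are integrable for every finite measure,
provided they are measurable. -/
theorem integrable_of_add_bounded {X : Type*} [MeasurableSpace X] {g h : X → ℝ} {C : ℝ}
    (hg : Measurable g) (hh : Measurable h) (hC : ∀ x y, |g x + h y| ≤ C)
    (μ : Measure X) [IsProbabilityMeasure μ] : Integrable g μ ∧ Integrable h μ := by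
  obtain ⟨z⟩ := μ.nonempty_of_neZero
  constructor
  · refine Integrable.of_bound hg.aestronglyMeasurable (C + |h z|) (.of_forall fun x ↦ ?_)
    have := abs_sub (g x + h z) (h z)
    rw [add_sub_cancel_right] at this
    exact this.trans (by gcongr; exact hC x z)
  · refine Integrable.of_bound hh.aestronglyMeasurable (C + |g z|) (.of_forall fun x ↦ ?_)
    have := abs_sub (g z + h x) (g z)
    rw [add_sub_cancel_left] at this
    exact this.trans (by gcongr; exact hC z x)

/-- For the original GAN objective
`τ(μ‖ν) = sup_u E_{x∼μ, y∼ν}[log u(x) + log(1 − u(y))]`, where the supremum ranges over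
the discriminators `u : X → (0,1)` continuous (with the induced objective function
`(x,y) ↦ log u(x) + log(1 − u(y))` bounded continuous on `X × X`, per the adversarial
divergence framework), one has `τ(μ‖μ) = −log 4` for every probability measure `μ`, and
`τ(μ‖ν) ≥ −log 4` for all probability measures `μ, ν`. -/
theorem stmt16 {X : Type*} [TopologicalSpace X] [MeasurableSpace X] [BorelSpace X]
    (F : Set (BoundedContinuousFunction (X × X) ℝ))
    (hF : F = {f : BoundedContinuousFunction (X × X) ℝ | ∃ u : C(X, ℝ),
      (∀ x, u x ∈ Set.Ioo (0 : ℝ) 1) ∧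
      ∀ p : X × X, f p = Real.log (u p.1) + Real.log (1 - u p.2)})
    (τ : ProbabilityMeasure X → ProbabilityMeasure X → EReal)
    (hτ : ∀ μ ν : ProbabilityMeasure X, τ μ ν = ⨆ f ∈ F,
      (((∫ p, f p ∂((μ : Measure X).prod (ν : Measure X))) : ℝ) : EReal)) :
    (∀ μ : ProbabilityMeasure X, τ μ μ = ((-Real.log 4 : ℝ) : EReal)) ∧
    (∀ μ ν : ProbabilityMeasure X, ((-Real.log 4 : ℝ) : EReal) ≤ τ μ ν) := by
  have lower : ∀ μ ν : ProbabilityMeasure X, ((-Real.log 4 : ℝ) : EReal) ≤ τ μ ν := by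
    intro μ ν
    rw [hτ]
    have hmem : BoundedContinuousFunction.const (X × X) (-Real.log 4) ∈ F := by
      rw [hF]
      refine ⟨ContinuousMap.const X (1 / 2), fun x ↦ by norm_num, fun p ↦ ?_⟩
      simp only [BoundedContinuousFunction.const_apply, ContinuousMap.const_apply]
      rw [← Real.log_mul (by norm_num) (by norm_num), ← Real.log_inv]
      norm_num
    refine le_trans (le_of_eq ?_) (le_iSup₂ _ hmem)
    simp
  refine ⟨fun μ ↦ le_antisymm ?_ (lower μ μ), lower⟩
  rw [hτ]
  refine iSup₂_le fun f hf ↦ ?_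
  rw [hF] at hf
  obtain ⟨u, hu, hfu⟩ := hf
  have hg : Measurable fun x ↦ Real.log (u x) := u.continuous.measurable.log
  have hh : Measurable fun x ↦ Real.log (1 - u x) := (u.continuous.measurable.const_sub 1).log
  obtain ⟨ig, ih⟩ := integrable_of_add_bounded hg hh
    (fun x y ↦ by simpa only [hfu, Real.norm_eq_abs] using f.norm_coe_le_norm (x, y))
    (μ : Measure X)
  rw [EReal.coe_le_coe_iff]
  calc ∫ p, f p ∂((μ : Measure X).prod (μ : Measure X))
      = ∫ x, Real.log (u x) ∂(μ : Measure X) + ∫ x, Real.log (1 - u x) ∂(μ : Measure X) := by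
        simp only [hfu]
        rw [integral_add (ig.comp_fst _) (ih.comp_snd _),
          integral_fun_fst (fun x ↦ Real.log (u x)), integral_fun_snd (fun x ↦ Real.log (1 - u x))]
        simp
    _ = ∫ x, (Real.log (u x) + Real.log (1 - u x)) ∂(μ : Measure X) := (integral_add ig ih).symm
    _ ≤ ∫ _, -Real.log 4 ∂(μ : Measure X) :=
        integral_mono (ig.add ih) (integrable_const _) fun x ↦ log_add_log_one_sub_le (hu x)
    _ = -Real.log 4 := by simp
end

section
/- Let X be a topological space and let f: ℝ → ℝ∪{+∞} be a convex lower semi-continuous function whose convex conjugate f* satisfies f*(x) ≥ x for all x ∈ ℝ and f*(x₀) = x₀ for some x₀ in the interior of the effective domain of f*. Let V be the set of bounded continuous functions v: X → ℝ with values in dom f*, and define the f-GAN objective τ(μ||ν) = sup_{v∈V} E_{x∼μ, y∼ν}[ v(x) − f*(v(y)) ] for Borel probability measures μ, ν on X. Then for every probability measure μ on X, τ(μ||μ) = 0, and for all probability measures μ, ν on X, τ(μ||ν) ≥ 0. -/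
open MeasureTheory

/-- A bounded continuous function on `X × X` of the form `(x, y) ↦ v x - w y` with `v ≤ w` has
nonpositive integral against the square of a probability measure. -/
theorem integral_prod_self_nonpos {X : Type*} [TopologicalSpace X] [MeasurableSpace X]
    [BorelSpace X] (g : BoundedContinuousFunction (X × X) ℝ) (v : BoundedContinuousFunction X ℝ)
    (w : X → ℝ) (hvw : ∀ x, v x ≤ w x) (hg : ∀ p : X × X, g p = v p.1 - w p.2)
    (μ : Measure X) [IsProbabilityMeasure μ] : ∫ p, g p ∂(μ.prod μ) ≤ 0 := by
  obtain ⟨a⟩ : Nonempty X := μ.nonempty_of_neZero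
  have hv_int : Integrable v μ := v.integrable μ
  have hw_int : Integrable w μ := by
    have h := (BoundedContinuousFunction.const X (v a) -
      g.compContinuous ⟨fun y => (a, y), by fun_prop⟩).integrable μ
    refine h.congr (ae_of_all _ fun y => ?_)
    simp [hg]
  simp_rw [hg]
  rw [integral_sub (hv_int.comp_fst μ) (hw_int.comp_snd μ), integral_fun_fst, integral_fun_snd]
  simpa using integral_mono hv_int hw_int hvw

/-- Let `f : ℝ → ℝ ∪ {+∞}` be convex and lower semi-continuous with convex
conjugate `f*` satisfying `f*(x) ≥ x` for all `x` and `f*(x₀) = x₀` for some `x₀` in the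
interior of the effective domain of `f*`. For the f-GAN objective
`τ(μ‖ν) = sup_v E_{x∼μ, y∼ν}[v(x) − f*(v(y))]`, where the supremum ranges over bounded
continuous discriminators `v : X → ℝ` with values in `dom f*` (with the induced objective
function bounded continuous on `X × X`, per the adversarial divergence framework), one has
`τ(μ‖μ) = 0` for every probability measure `μ`, and `τ(μ‖ν) ≥ 0` for all `μ, ν`. -/
theorem stmt17 {X : Type*} [TopologicalSpace X] [MeasurableSpace X] [BorelSpace X]
    (f : ℝ → EReal) (hf_bot : ∀ x : ℝ, f x ≠ ⊥)
    (hf_cvx : ∀ a b x y : ℝ, 0 ≤ a → 0 ≤ b → a + b = 1 →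
      f (a * x + b * y) ≤ (a : EReal) * f x + (b : EReal) * f y)
    (hf_lsc : LowerSemicontinuous f)
    (fstar : ℝ → EReal)
    (hfstar : ∀ t : ℝ, fstar t = ⨆ x : ℝ, (((t * x : ℝ) : EReal) - f x))
    (hge : ∀ x : ℝ, (x : EReal) ≤ fstar x)
    (x₀ : ℝ) (hx₀mem : x₀ ∈ interior {t : ℝ | fstar t ≠ ⊤})
    (hx₀ : fstar x₀ = (x₀ : EReal))
    (F : Set (BoundedContinuousFunction (X × X) ℝ))
    (hF : F = {g : BoundedContinuousFunction (X × X) ℝ |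
      ∃ v : BoundedContinuousFunction X ℝ, (∀ x, fstar (v x) ≠ ⊤) ∧
      ∀ p : X × X, g p = v p.1 - (fstar (v p.2)).toReal})
    (τ : ProbabilityMeasure X → ProbabilityMeasure X → EReal)
    (hτ : ∀ μ ν : ProbabilityMeasure X, τ μ ν = ⨆ g ∈ F,
      (((∫ p, g p ∂((μ : Measure X).prod (ν : Measure X))) : ℝ) : EReal)) :
    (∀ μ : ProbabilityMeasure X, τ μ μ = 0) ∧
    (∀ μ ν : ProbabilityMeasure X, (0 : EReal) ≤ τ μ ν) := by
  have hnonneg : ∀ μ ν : ProbabilityMeasure X, (0 : EReal) ≤ τ μ ν := by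
    intro μ ν
    have hmem : (0 : BoundedContinuousFunction (X × X) ℝ) ∈ F := by
      rw [hF]
      exact ⟨BoundedContinuousFunction.const X x₀, by simp [hx₀], by simp [hx₀]⟩
    rw [hτ]
    refine le_iSup₂_of_le 0 hmem ?_
    simp
  refine ⟨fun μ => le_antisymm ?_ (hnonneg μ μ), hnonneg⟩
  rw [hτ]
  refine iSup₂_le fun g hg => ?_
  rw [hF] at hg
  obtain ⟨v, hv, hgv⟩ := hg
  exact_mod_cast integral_prod_self_nonpos g v (fun x => (fstar (v x)).toReal)
    (fun x => by
      simpa using EReal.toReal_le_toReal (hge (v x)) (EReal.coe_ne_bot _) (hv x)) hgv (μ : Measure X)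
end
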